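/- arXiv:math/0203221 — 3 statements merged into one kernel-verified Lean document; each statement's English description precedes it below -/
import Mathlib

section
/- Let (F,𝓕) be the space of measurable mappings of a compact metric space M into itself, with 𝓕 generated by the evaluation maps φ ↦ φ(x). Let Q₁, Q₂ be probability measures on (F,𝓕) with Q₁ regular, i.e., admitting a measurable presentation 𝒥 (a measurable map F → F with (x,φ) ↦ 𝒥(φ)(x) jointly measurable and, for each x, 𝒥(φ)(x) = φ(x) for Q₁-a.e. φ). Then the map (φ₁,φ₂) ↦ 𝒥(φ₁) ∘ φ₂ from (F², 𝓕⊗𝓕) to (F,𝓕) is measurable, and if 𝒥′ is another measurable presentation of Q₁, then for every x ∈ M, 𝒥(φ₁)∘φ₂(x) = 𝒥′(φ₁)∘φ₂(x) for Q₁⊗Q₂-a.e. (φ₁,φ₂). In particular the law of 𝒥(φ₁)∘φ₂ under Q₁⊗Q₂ does not depend on the choice of presentation. -/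
open MeasureTheory

/-- The space of measurable self-maps of a compact metric space. -/
def FF (M : Type*) [MeasurableSpace M] : Type _ := {φ : M → M // Measurable φ}

/-- The σ-field on `FF M` generated by the evaluation maps `φ ↦ φ(x)`. -/
instance FF.instMeasurableSpace (M : Type*) [MeasurableSpace M] : MeasurableSpace (FF M) :=
  ⨆ x : M, MeasurableSpace.comap (fun φ : FF M => φ.1 x) inferInstance

/-- Composition in `FF M`. -/
def FF.comp {M : Type*} [MeasurableSpace M] (φ ψ : FF M) : FF M :=
  ⟨φ.1 ∘ ψ.1, φ.2.comp ψ.2⟩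

lemma FF.measurable_eval {M : Type*} [MeasurableSpace M] (x : M) :
    Measurable fun φ : FF M => φ.1 x :=
  Measurable.of_comap_le (le_iSup
    (fun x : M => MeasurableSpace.comap (fun φ : FF M => φ.1 x) inferInstance) x)

lemma FF.measurable_of_eval {M α : Type*} [MeasurableSpace M] [MeasurableSpace α]
    {f : α → FF M} (hf : ∀ x, Measurable fun a => (f a).1 x) : Measurable f := by
  refine Measurable.of_le_map (iSup_le fun x => ?_)
  rintro _ ⟨t, ht, rfl⟩
  exact hf x ht

lemma FF.preimage_ae_eq {M α : Type*} [MeasurableSpace M] [MeasurableSpace α] {μ : Measure α}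
    {f g : α → FF M} (h : ∀ x, ∀ᵐ a ∂μ, (f a).1 x = (g a).1 x) {s : Set (FF M)}
    (hs : MeasurableSet s) : ∀ᵐ a ∂μ, f a ∈ s ↔ g a ∈ s := by
  have hs' := MeasurableSpace.measurableSet_iSup.1 hs
  induction hs' with
  | basic u hu =>
    obtain ⟨x, t, -, rfl⟩ := hu
    filter_upwards [h x] with a ha
    simp [ha]
  | empty => simp
  | compl t ht ih =>
    filter_upwards [ih (MeasurableSpace.measurableSet_iSup.2 ht)] with a ha
    simp [ha]
  | iUnion t ht ih =>
    filter_upwards [ae_all_iff.2 fun n => ih n (MeasurableSpace.measurableSet_iSup.2 (ht n))]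
      with a ha
    simp [ha]

/-- Random elements of `FF M` that are modifications of each other have the same law. -/
lemma FF.map_eq_of_eval_ae_eq {M α : Type*} [MeasurableSpace M] [MeasurableSpace α]
    {μ : Measure α} {f g : α → FF M} (hf : Measurable f) (hg : Measurable g)
    (h : ∀ x, ∀ᵐ a ∂μ, (f a).1 x = (g a).1 x) : μ.map f = μ.map g := by
  ext s hs
  rw [Measure.map_apply hf hs, Measure.map_apply hg hs]
  refine measure_congr ?_
  filter_upwards [FF.preimage_ae_eq h hs] with a ha
  exact propext ha

lemma FF.measurable_presentation_eval {M : Type*} [MeasurableSpace M] {𝒥 : FF M → FF M}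
    (h : Measurable fun p : M × FF M => (𝒥 p.2).1 p.1) (x : M) :
    Measurable fun p : FF M × FF M => (𝒥 p.1).1 (p.2.1 x) :=
  h.comp (((FF.measurable_eval x).comp measurable_snd).prodMk measurable_fst)

/-- If `Q₁` is regular, with measurable presentation `𝒥`, then `(φ₁, φ₂) ↦ 𝒥(φ₁) ∘ φ₂`
is measurable; and if `𝒥'` is another measurable presentation of `Q₁`, then for every
`x`, `𝒥(φ₁) ∘ φ₂ (x) = 𝒥'(φ₁) ∘ φ₂ (x)` for `Q₁ ⊗ Q₂`-a.e. `(φ₁, φ₂)`; in particular the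
law of `𝒥(φ₁) ∘ φ₂` does not depend on the choice of presentation. -/
theorem stmt1 {M : Type*} [MetricSpace M] [CompactSpace M]
    [MeasurableSpace M] [BorelSpace M]
    (Q₁ Q₂ : Measure (FF M)) [IsProbabilityMeasure Q₁] [IsProbabilityMeasure Q₂]
    (𝒥 : FF M → FF M) (h𝒥m : Measurable 𝒥)
    (h𝒥joint : Measurable fun p : M × FF M => (𝒥 p.2).1 p.1)
    (h𝒥pres : ∀ x : M, ∀ᵐ φ ∂Q₁, (𝒥 φ).1 x = φ.1 x) :
    Measurable (fun p : FF M × FF M => FF.comp (𝒥 p.1) p.2) ∧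
    ∀ (𝒥' : FF M → FF M), Measurable 𝒥' →
      Measurable (fun p : M × FF M => (𝒥' p.2).1 p.1) →
      (∀ x : M, ∀ᵐ φ ∂Q₁, (𝒥' φ).1 x = φ.1 x) →
      (∀ x : M, ∀ᵐ p ∂(Q₁.prod Q₂), (𝒥 p.1).1 (p.2.1 x) = (𝒥' p.1).1 (p.2.1 x)) ∧
      Measure.map (fun p : FF M × FF M => FF.comp (𝒥 p.1) p.2) (Q₁.prod Q₂)
        = Measure.map (fun p : FF M × FF M => FF.comp (𝒥' p.1) p.2) (Q₁.prod Q₂) := by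
  have hcomp : ∀ 𝒦 : FF M → FF M, (Measurable fun p : M × FF M => (𝒦 p.2).1 p.1) →
      Measurable (fun p : FF M × FF M => FF.comp (𝒦 p.1) p.2) := fun 𝒦 h =>
    FF.measurable_of_eval (FF.measurable_presentation_eval h)
  refine ⟨hcomp 𝒥 h𝒥joint, fun 𝒥' _ hjoint hpres => ?_⟩
  have hae : ∀ x : M, ∀ᵐ p ∂(Q₁.prod Q₂), (𝒥 p.1).1 (p.2.1 x) = (𝒥' p.1).1 (p.2.1 x) := by
    intro x
    have hm : MeasurableSet
        {p : FF M × FF M | (𝒥 p.1).1 (p.2.1 x) = (𝒥' p.1).1 (p.2.1 x)} :=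
      measurableSet_eq_fun (FF.measurable_presentation_eval h𝒥joint x)
        (FF.measurable_presentation_eval hjoint x)
    rw [Measure.ae_prod_iff_ae_ae hm, Measure.ae_ae_comm hm]
    refine Filter.Eventually.of_forall fun φ₂ => ?_
    filter_upwards [h𝒥pres (φ₂.1 x), hpres (φ₂.1 x)] with φ₁ h₁ h₂
    rw [h₁, h₂]
  exact ⟨hae, FF.map_eq_of_eval_ae_eq (hcomp 𝒥 h𝒥joint) (hcomp 𝒥' hjoint) hae⟩
end

section
/- Let (P_t^{(n)})_{n≥1} be a compatible family of Markovian kernel semigroups on a compact metric space M. Suppose condition (F) holds: for all f ∈ C(M) and x ∈ M, P_t^{(1)} f(x) → f(x) as t → 0; and for all x ∈ M, ε > 0, t > 0, P_t^{(2)} 1_{{(u,v) : d(u,v) > ε}}(x,y) → 0 as y → x. Then each P_t^{(n)} is a Feller semigroup on C(Mⁿ), i.e., maps C(Mⁿ) to C(Mⁿ) and P_t^{(n)} h → h pointwise (hence uniformly) as t → 0. -/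
open MeasureTheory ProbabilityTheory Filter Topology
open scoped NNReal

/-- On a compact Hausdorff space, a bounded sequence of continuous functions converging pointwise
to zero has convex combinations of arbitrarily small uniform norm. -/
theorem exists_mem_convexHull_norm_lt {X : Type*} [TopologicalSpace X] [CompactSpace X]
    [T2Space X] (f : ℕ → C(X, ℝ)) (C : ℝ) (hC : ∀ k x, |f k x| ≤ C)
    (hf : ∀ x, Tendsto (fun k => f k x) atTop (𝓝 0)) {ε : ℝ} (hε : 0 < ε) :
    ∃ w ∈ convexHull ℝ (Set.range f), ‖w‖ < ε := by
  by_contra! hcon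
  let S : Set C(X, ℝ) := {g | ∃ w ∈ convexHull ℝ (Set.range f), ∀ x, |w x| ≤ g x}
  have hSconv : Convex ℝ S := by
    rintro g₁ ⟨w₁, hw₁, h₁⟩ g₂ ⟨w₂, hw₂, h₂⟩ a b ha hb hab
    refine ⟨a • w₁ + b • w₂, convex_convexHull ℝ _ hw₁ hw₂ ha hb hab, fun x => ?_⟩
    simp only [ContinuousMap.add_apply, ContinuousMap.smul_apply, smul_eq_mul]
    calc |a * w₁ x + b * w₂ x| ≤ |a * w₁ x| + |b * w₂ x| := abs_add_le _ _
      _ = a * |w₁ x| + b * |w₂ x| := by rw [abs_mul, abs_mul, abs_of_nonneg ha, abs_of_nonneg hb]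
      _ ≤ a * g₁ x + b * g₂ x := by gcongr <;> simp [h₁, h₂]
  have hSf (k : ℕ) (g : C(X, ℝ)) (hg : ∀ x, 0 ≤ g x) : |f k| + g ∈ S :=
    ⟨f k, subset_convexHull ℝ _ ⟨k, rfl⟩, fun x => by simpa using hg x⟩
  have hdisj : Disjoint (Metric.ball (0 : C(X, ℝ)) ε) S := by
    rw [Set.disjoint_left]
    rintro g hg ⟨w, hw, hwg⟩
    rw [mem_ball_zero_iff] at hg
    refine (hcon w hw).not_gt (((ContinuousMap.norm_le _ (norm_nonneg g)).2 fun x => ?_).trans_lt hg)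
    exact (hwg x).trans ((le_abs_self _).trans (g.norm_coe_le_norm x))
  obtain ⟨L, u, hLball, hLS⟩ :=
    geometric_hahn_banach_open (convex_ball (0 : C(X, ℝ)) ε) Metric.isOpen_ball hSconv hdisj
  have hu : 0 < u := by simpa using hLball 0 (Metric.mem_ball_self hε)
  have hLpos (g : C(X, ℝ)) (hg : 0 ≤ g) : 0 ≤ L g := by
    by_contra! hneg
    obtain ⟨n, hn⟩ := exists_nat_gt ((L |f 0| - u) / (-L g))
    rw [div_lt_iff₀ (by linarith)] at hn
    have := hLS _ (hSf 0 ((n : ℝ) • g) fun x => mul_nonneg (Nat.cast_nonneg n) (hg x))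
    rw [map_add, map_smul, smul_eq_mul] at this
    linarith
  let : MeasurableSpace X := borel X
  have : BorelSpace X := ⟨rfl⟩
  let Λ : CompactlySupportedContinuousMap X ℝ →ₚ[ℝ] ℝ :=
    { toFun g := L g.toContinuousMap
      map_add' g g' := L.map_add g.toContinuousMap g'.toContinuousMap
      map_smul' c g := L.map_smul c g.toContinuousMap
      monotone' g g' hgg' := by
        have := hLpos (g'.toContinuousMap - g.toContinuousMap) fun x => sub_nonneg.2 (hgg' x)
        rw [map_sub] at this
        exact sub_nonneg.1 this }
  let μ := RealRMK.rieszMeasure Λ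
  have hμ (g : C(X, ℝ)) : ∫ x, g x ∂μ = L g :=
    RealRMK.integral_rieszMeasure Λ (CompactlySupportedContinuousMap.continuousMapEquiv g)
  have hlim : Tendsto (fun k => ∫ x, |f k| x ∂μ) atTop (𝓝 (∫ _, (0 : ℝ) ∂μ)) := by
    refine tendsto_integral_of_dominated_convergence (fun _ => C)
      (fun k => (map_continuous _).aestronglyMeasurable) (integrable_const C)
      (fun k => ae_of_all _ fun x => by simpa using hC k x) (ae_of_all _ fun x => ?_)
    simpa using (hf x).abs
  rw [integral_zero] at hlim
  refine hu.not_ge (ge_of_tendsto' hlim fun k => ?_)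
  rw [hμ]
  simpa using hLS _ (hSf k 0 fun x => le_rfl)

theorem abs_integral_kernel_le {X : Type*} [MeasurableSpace X] (κ : ℝ≥0 → Kernel X X)
    [∀ t, IsMarkovKernel (κ t)] {h : X → ℝ} {C : ℝ} (hC : ∀ x, |h x| ≤ C) (t : ℝ≥0) (x : X) :
    |∫ y, h y ∂κ t x| ≤ C := by
  simpa using norm_integral_le_of_norm_le_const (μ := κ t x)
    (ae_of_all _ fun y => (Real.norm_eq_abs _).trans_le (hC y))

/-- The average over the times in `[0, s]` of the semigroup applied to `h`. -/
noncomputable def timeAverage {X : Type*} [MeasurableSpace X] (κ : ℝ≥0 → Kernel X X)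
    (h : X → ℝ) (s : ℝ) (x : X) : ℝ :=
  s⁻¹ * ∫ r in (0 : ℝ)..s, ∫ y, h y ∂κ r.toNNReal x

theorem abs_timeAverage_le {X : Type*} [MeasurableSpace X] {κ : ℝ≥0 → Kernel X X}
    [∀ t, IsMarkovKernel (κ t)] {h : X → ℝ} {C : ℝ} (hC : ∀ x, |h x| ≤ C) {s : ℝ}
    (hs : 0 < s) (x : X) :
    |timeAverage κ h s x| ≤ C := by
  have := intervalIntegral.norm_integral_le_of_norm_le_const (a := 0) (b := s)
    (f := fun r : ℝ => ∫ y, h y ∂κ r.toNNReal x) fun r _ => abs_integral_kernel_le κ hC _ x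
  rw [sub_zero, abs_of_pos hs, Real.norm_eq_abs] at this
  rw [timeAverage, abs_mul, abs_of_pos (inv_pos.2 hs), inv_mul_le_iff₀ hs]
  linarith

section Semigroup

variable {X : Type*} [TopologicalSpace X] [MeasurableSpace X] [BorelSpace X]
  (κ : ℝ≥0 → Kernel X X)

theorem Continuous.integrable_of_compactSpace [CompactSpace X] {μ : Measure X}
    [IsFiniteMeasure μ] {h : X → ℝ} (hh : Continuous h) : Integrable h μ := by
  obtain ⟨C, hC⟩ := isCompact_univ.exists_bound_of_continuousOn hh.continuousOn
  exact .of_bound hh.aestronglyMeasurable C (ae_of_all _ fun x => hC x trivial)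

theorem integral_kernel_add [CompactSpace X] [∀ t, IsMarkovKernel (κ t)]
    (hsemi : ∀ s t x, (κ s x).bind (κ t) = κ (s + t) x) {h : X → ℝ} (hh : Continuous h)
    (s t : ℝ≥0) (x : X) : ∫ y, h y ∂κ (s + t) x = ∫ z, ∫ y, h y ∂κ t z ∂κ s x := by
  have : κ (s + t) = κ t ∘ₖ κ s := by
    ext1 x
    rw [Kernel.comp_apply, hsemi]
  rw [this]
  exact Kernel.integral_comp hh.integrable_of_compactSpace


/-- A semigroup of kernels acting on continuous functions and pointwise continuous at time zero. -/
structure IsPointwiseFeller (κ : ℝ≥0 → Kernel X X) : Prop where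
  bind_eq : ∀ s t x, (κ s x).bind (κ t) = κ (s + t) x
  continuous_integral : ∀ t (h : X → ℝ), Continuous h → Continuous fun x => ∫ y, h y ∂κ t x
  tendsto_integral : ∀ h : X → ℝ, Continuous h → ∀ x,
    Tendsto (fun t => ∫ y, h y ∂κ t x) (𝓝 0) (𝓝 (h x))

namespace IsPointwiseFeller

variable {κ} [CompactSpace X] [∀ t, IsMarkovKernel (κ t)] {h : X → ℝ}

theorem tendsto_integral_add (hκ : IsPointwiseFeller κ) (hh : Continuous h) (t : ℝ≥0) (x : X) :
    Tendsto (fun u => ∫ y, h y ∂κ (t + u) x) (𝓝 0) (𝓝 (∫ y, h y ∂κ t x)) := by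
  refine (hκ.tendsto_integral _ (hκ.continuous_integral t h hh) x).congr fun u => ?_
  rw [add_comm, integral_kernel_add κ hκ.bind_eq hh]

theorem measurable_integral (hκ : IsPointwiseFeller κ) (hh : Continuous h) :
    Measurable fun p : ℝ≥0 × X => ∫ y, h y ∂κ p.1 p.2 := by
  let τ (k : ℕ) (t : ℝ≥0) : ℝ≥0 := (⌊t * (k + 1)⌋₊ + 1) / (k + 1)
  have hτ_le (k t) : t ≤ τ k t := by
    rw [le_div_iff₀ (by positivity)]
    exact (Nat.lt_floor_add_one _).le
  have hτ_ub (k t) : τ k t ≤ t + 1 / (k + 1) := by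
    rw [div_le_iff₀ (by positivity), add_mul, one_div_mul_cancel (by positivity)]
    gcongr
    exact Nat.floor_le zero_le
  have hlim (t) : Tendsto (fun k => τ k t - t) atTop (𝓝 0) :=
    tendsto_of_tendsto_of_tendsto_of_le_of_le tendsto_const_nhds
      (tendsto_one_div_add_atTop_nhds_zero_nat (𝕜 := ℝ≥0)) (fun _ => zero_le)
      fun k => tsub_le_iff_left.2 (hτ_ub k t)
  refine measurable_of_tendsto_metrizable (f := fun k (p : ℝ≥0 × X) => ∫ y, h y ∂κ (τ k p.1) p.2)
    (fun k => ?_) (tendsto_pi_nhds.2 fun p => ?_)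
  · have hdisc (ρ : ℕ → ℝ≥0) : Measurable fun q : ℕ × X => ∫ y, h y ∂κ (ρ q.1) q.2 :=
      measurable_from_prod_countable_right fun m =>
        (hκ.continuous_integral (ρ m) h hh).measurable
    have hfloor : Measurable fun p : ℝ≥0 × X => (⌊p.1 * (k + 1)⌋₊, p.2) :=
      (measurable_fst.mul_const _).nat_floor.prodMk measurable_snd
    simpa only [Function.comp_def] using (hdisc fun m => (m + 1) / (k + 1)).comp hfloor
  · refine ((hκ.tendsto_integral_add hh p.1 p.2).comp (hlim p.1)).congr fun k => ?_
    simp only [Function.comp_apply, add_tsub_cancel_of_le (hτ_le k p.1)]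

theorem measurable_integral_toNNReal (hκ : IsPointwiseFeller κ) (hh : Continuous h) :
    Measurable fun p : ℝ × X => ∫ y, h y ∂κ p.1.toNNReal p.2 :=
  (hκ.measurable_integral hh).comp (measurable_real_toNNReal.prodMap measurable_id)

theorem intervalIntegrable (hκ : IsPointwiseFeller κ) (hh : Continuous h) (x : X) (a b : ℝ) :
    IntervalIntegrable (fun r : ℝ => ∫ y, h y ∂κ r.toNNReal x) volume a b := by
  obtain ⟨C, hC⟩ := isCompact_univ.exists_bound_of_continuousOn hh.continuousOn
  refine (intervalIntegrable_const (c := C)).mono_fun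
    ((hκ.measurable_integral_toNNReal hh).comp measurable_prodMk_right).aestronglyMeasurable
    (ae_of_all _ fun r => ?_)
  exact (abs_integral_kernel_le κ (fun y => hC y trivial) _ x).trans (le_abs_self C)

theorem continuous_timeAverage [FirstCountableTopology X] (hκ : IsPointwiseFeller κ)
    (hh : Continuous h) (s : ℝ) : Continuous (timeAverage κ h s) := by
  obtain ⟨C, hC⟩ := isCompact_univ.exists_bound_of_continuousOn hh.continuousOn
  refine continuous_const.mul (intervalIntegral.continuous_of_dominated_interval
    (bound := fun _ => C) (fun x => ?_) (fun x => ae_of_all _ fun r _ => ?_)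
    intervalIntegrable_const (ae_of_all _ fun r _ => hκ.continuous_integral _ h hh))
  · exact ((hκ.measurable_integral_toNNReal hh).comp measurable_prodMk_right).aestronglyMeasurable
  · exact abs_integral_kernel_le κ (fun y => hC y trivial) _ x

theorem tendsto_timeAverage (hκ : IsPointwiseFeller κ) (hh : Continuous h) (x : X) :
    Tendsto (fun s => timeAverage κ h s x) (𝓝[>] 0) (𝓝 (h x)) := by
  have hlim : Tendsto (fun r : ℝ => ∫ y, h y ∂κ r.toNNReal x) (𝓝 0) (𝓝 (h x)) :=
    (hκ.tendsto_integral h hh x).comp (by simpa using (continuous_real_toNNReal.tendsto 0))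
  rw [Metric.tendsto_nhds] at hlim ⊢
  intro ε hε
  obtain ⟨δ, hδ, hball⟩ := Metric.eventually_nhds_iff.1 (hlim (ε / 2) (half_pos hε))
  filter_upwards [Ioo_mem_nhdsGT hδ] with s ⟨hs, hsδ⟩
  have hbound := intervalIntegral.norm_integral_le_of_norm_le_const (a := 0) (b := s) (C := ε / 2)
    (f := fun r : ℝ => (∫ y, h y ∂κ r.toNNReal x) - h x) fun r hr => by
      rw [Set.uIoc_of_le hs.le] at hr
      exact (hball (by rw [Real.dist_0_eq_abs, abs_of_pos hr.1]; linarith [hr.2])).le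
  rw [intervalIntegral.integral_sub (hκ.intervalIntegrable hh x 0 s) intervalIntegrable_const,
    intervalIntegral.integral_const, sub_zero, smul_eq_mul, abs_of_pos hs, Real.norm_eq_abs]
    at hbound
  have : timeAverage κ h s x - h x =
      s⁻¹ * ((∫ r in (0 : ℝ)..s, ∫ y, h y ∂κ r.toNNReal x) - s * h x) := by
    rw [timeAverage, mul_sub, inv_mul_cancel_left₀ hs.ne']
  rw [Real.dist_eq, this, abs_mul, abs_of_pos (inv_pos.2 hs), inv_mul_lt_iff₀ hs]
  nlinarith

theorem integral_timeAverage (hκ : IsPointwiseFeller κ) (hh : Continuous h) {s : ℝ} (hs : 0 < s)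
    (t : ℝ≥0) (x : X) : ∫ y, timeAverage κ h s y ∂κ t x =
      s⁻¹ * ∫ r in (t : ℝ)..(s + t), ∫ y, h y ∂κ r.toNNReal x := by
  obtain ⟨C, hC⟩ := isCompact_univ.exists_bound_of_continuousOn hh.continuousOn
  simp only [timeAverage]
  rw [integral_const_mul, ← intervalIntegral_integral_swap]
  · have := intervalIntegral.integral_comp_add_right (a := 0) (b := s)
      (fun r : ℝ => ∫ y, h y ∂κ r.toNNReal x) (t : ℝ)
    rw [zero_add] at this
    rw [← this]
    congr 1
    refine intervalIntegral.integral_congr fun r hr => ?_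
    rw [Set.uIcc_of_le hs.le] at hr
    rw [Real.toNNReal_add hr.1 t.coe_nonneg, Real.toNNReal_coe, add_comm,
      integral_kernel_add κ hκ.bind_eq hh]
  · have : IsFiniteMeasure (volume.restrict (Set.uIoc 0 s)) := by
      rw [Set.uIoc_of_le hs.le]
      infer_instance
    refine .of_bound (hκ.measurable_integral_toNNReal hh).aestronglyMeasurable C
      (ae_of_all _ fun p => ?_)
    exact abs_integral_kernel_le κ (fun y => hC y trivial) _ p.2

theorem tendstoUniformly_timeAverage (hκ : IsPointwiseFeller κ) (hh : Continuous h) {s : ℝ}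
    (hs : 0 < s) :
    TendstoUniformly (fun t x => ∫ y, timeAverage κ h s y ∂κ t x) (timeAverage κ h s) (𝓝 0) := by
  obtain ⟨C, hC⟩ := isCompact_univ.exists_bound_of_continuousOn hh.continuousOn
  have hbound (t : ℝ≥0) (x : X) :
      dist (timeAverage κ h s x) (∫ y, timeAverage κ h s y ∂κ t x) ≤ s⁻¹ * (2 * C * t) := by
    have hI := hκ.intervalIntegrable hh x
    have hle (a b : ℝ) := intervalIntegral.norm_integral_le_of_norm_le_const (a := a) (b := b)
      (f := fun r : ℝ => ∫ y, h y ∂κ r.toNNReal x)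
      fun r _ => abs_integral_kernel_le κ (fun y => hC y trivial) _ x
    have h₁ := hle s (s + t)
    have h₂ := hle 0 t
    rw [dist_comm, Real.dist_eq, hκ.integral_timeAverage hh hs, timeAverage, ← mul_sub,
      intervalIntegral.integral_interval_sub_interval_comm' (hI _ _) (hI _ _) (hI _ _), abs_mul,
      abs_of_pos (inv_pos.2 hs)]
    gcongr
    simp only [add_sub_cancel_left, sub_zero, NNReal.abs_eq, Real.norm_eq_abs] at h₁ h₂
    linarith [abs_sub (∫ r in s..(s + t), ∫ y, h y ∂κ r.toNNReal x)
      (∫ r in (0 : ℝ)..t, ∫ y, h y ∂κ r.toNNReal x)]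
  have hlim : Tendsto (fun t : ℝ≥0 => s⁻¹ * (2 * C * t)) (𝓝 0) (𝓝 0) := by
    have : Continuous fun t : ℝ≥0 => s⁻¹ * (2 * C * (t : ℝ)) := by fun_prop
    simpa using this.tendsto 0
  rw [Metric.tendstoUniformly_iff]
  intro ε hε
  filter_upwards [hlim.eventually (gt_mem_nhds hε)] with t ht x using (hbound t x).trans_lt ht

theorem tendstoUniformly_integral [T2Space X] [FirstCountableTopology X]
    (hκ : IsPointwiseFeller κ) (hh : Continuous h) :
    TendstoUniformly (fun t x => ∫ y, h y ∂κ t x) h (𝓝 0) := by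
  obtain ⟨C, hC⟩ := isCompact_univ.exists_bound_of_continuousOn hh.continuousOn
  have hC' (x : X) : |h x| ≤ C := hC x trivial
  let s (k : ℕ) : ℝ := 1 / ((k : ℝ) + 1)
  have hs (k : ℕ) : 0 < s k := Nat.one_div_pos_of_nat
  have hs_lim : Tendsto s atTop (𝓝[>] 0) :=
    tendsto_nhdsWithin_iff.2 ⟨tendsto_one_div_add_atTop_nhds_zero_nat, .of_forall hs⟩
  let f (k : ℕ) : C(X, ℝ) := ⟨timeAverage κ h (s k), hκ.continuous_timeAverage hh (s k)⟩ - ⟨h, hh⟩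
  have hfC (k : ℕ) (x : X) : |f k x| ≤ C + C :=
    (abs_sub _ _).trans (add_le_add (abs_timeAverage_le hC' (hs k) x) (hC' x))
  have hf_lim (x : X) : Tendsto (fun k => f k x) atTop (𝓝 0) := by
    simpa [f] using ((hκ.tendsto_timeAverage hh x).comp hs_lim).sub_const (h x)
  let D : Set C(X, ℝ) := {w | TendstoUniformly (fun t x => ∫ y, (h y + w y) ∂κ t x)
    (fun x => h x + w x) (𝓝 0)}
  have hint (w : C(X, ℝ)) (t : ℝ≥0) (x : X) : Integrable w (κ t x) :=
    w.continuous.integrable_of_compactSpace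
  have hint' (t : ℝ≥0) (x : X) : Integrable h (κ t x) := hh.integrable_of_compactSpace
  have hDconv : Convex ℝ D := by
    intro w₁ h₁ w₂ h₂ a b ha hb hab
    simp only [D, Set.mem_ofPred_eq, Metric.tendstoUniformly_iff] at h₁ h₂ ⊢
    intro ε hε
    filter_upwards [h₁ (ε / 2) (half_pos hε), h₂ (ε / 2) (half_pos hε)] with t ht₁ ht₂ x
    specialize ht₁ x
    specialize ht₂ x
    rw [integral_add (hint' t x) (hint _ t x), Real.dist_eq] at ht₁ ht₂ ⊢
    simp only [ContinuousMap.add_apply, ContinuousMap.smul_apply, smul_eq_mul]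
    rw [integral_add ((hint _ t x).const_mul _) ((hint _ t x).const_mul _), integral_const_mul,
      integral_const_mul]
    set I := ∫ y, h y ∂κ t x
    set I₁ := ∫ y, w₁ y ∂κ t x
    set I₂ := ∫ y, w₂ y ∂κ t x
    obtain rfl : b = 1 - a := by linarith
    have : h x + (a * w₁ x + (1 - a) * w₂ x) - (I + (a * I₁ + (1 - a) * I₂)) =
      a * (h x + w₁ x - (I + I₁)) + (1 - a) * (h x + w₂ x - (I + I₂)) := by ring
    rw [this]
    refine (abs_add_le _ _).trans_lt ?_
    rw [abs_mul, abs_mul, abs_of_nonneg ha, abs_of_nonneg hb]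
    nlinarith
  have hfD : Set.range f ⊆ D := by
    rintro _ ⟨k, rfl⟩
    simpa [D, f] using hκ.tendstoUniformly_timeAverage hh (hs k)
  rw [Metric.tendstoUniformly_iff]
  intro ε hε
  obtain ⟨w, hw, hwε⟩ := exists_mem_convexHull_norm_lt f _ hfC hf_lim (ε := ε / 3) (by positivity)
  have hwD : w ∈ D := convexHull_min hfD hDconv hw
  filter_upwards [Metric.tendstoUniformly_iff.1 hwD (ε / 3) (by positivity)] with t ht x
  specialize ht x
  rw [integral_add (hint' t x) (hint _ t x), Real.dist_eq, abs_lt] at ht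
  have h₁ := abs_le.1 (w.norm_coe_le_norm x)
  have h₂ := abs_le.1 (abs_integral_kernel_le κ w.norm_coe_le_norm t x)
  rw [Real.dist_eq, abs_lt]
  constructor <;> linarith

end IsPointwiseFeller

end Semigroup

theorem abs_integral_le_add_mul_sum_measureReal {Ω ι : Type*} [MeasurableSpace Ω] [Fintype ι]
    (μ : Measure Ω) [IsProbabilityMeasure μ] {g : Ω → ℝ} (hg : Integrable g μ) {ε B : ℝ}
    (hε : 0 ≤ ε) (hB : ∀ ω, |g ω| ≤ B) {E : ι → Set Ω} (hE : ∀ i, MeasurableSet (E i))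
    (hgE : ∀ ω, (∀ i, ω ∉ E i) → |g ω| ≤ ε) :
    |∫ ω, g ω ∂μ| ≤ ε + B * ∑ i, μ.real (E i) := by
  have hind (i : ι) : Integrable ((E i).indicator (1 : Ω → ℝ)) μ :=
    (integrable_const 1).indicator (hE i)
  have hsum : Integrable (fun ω => B * ∑ i, (E i).indicator (1 : Ω → ℝ) ω) μ :=
    (integrable_finsetSum _ fun i _ => hind i).const_mul B
  calc |∫ ω, g ω ∂μ| ≤ ∫ ω, |g ω| ∂μ := abs_integral_le_integral_abs
    _ ≤ ∫ ω, (ε + B * ∑ i, (E i).indicator (1 : Ω → ℝ) ω) ∂μ := by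
      refine integral_mono hg.abs ((integrable_const ε).add hsum) fun ω => ?_
      have hnonneg (i : ι) : 0 ≤ (E i).indicator (1 : Ω → ℝ) ω :=
        Set.indicator_nonneg (fun _ _ => zero_le_one) ω
      have hB₀ : 0 ≤ B := (abs_nonneg _).trans (hB ω)
      by_cases hω : ∀ i, ω ∉ E i
      · exact (hgE ω hω).trans
          (le_add_of_nonneg_right (mul_nonneg hB₀ (Finset.sum_nonneg fun i _ => hnonneg i)))
      · push Not at hω
        obtain ⟨i, hi⟩ := hω
        have : 1 ≤ ∑ j, (E j).indicator (1 : Ω → ℝ) ω := by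
          simpa [hi] using
            Finset.single_le_sum (fun j _ => hnonneg j) (Finset.mem_univ i)
        calc |g ω| ≤ B := hB ω
          _ ≤ B * ∑ j, (E j).indicator (1 : Ω → ℝ) ω := le_mul_of_one_le_right hB₀ this
          _ ≤ _ := le_add_of_nonneg_left hε
    _ = ε + B * ∑ i, μ.real (E i) := by
      rw [integral_add (integrable_const ε) hsum, integral_const_mul,
        integral_finsetSum _ fun i _ => hind i]
      simp [integral_indicator_one (hE _)]

section NPoint

variable {M : Type*} [MetricSpace M] [CompactSpace M] [MeasurableSpace M] [BorelSpace M]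
  {κ : (n : ℕ) → ℝ≥0 → Kernel (Fin n → M) (Fin n → M)} [hm : ∀ n t, IsMarkovKernel (κ n t)]

theorem tendsto_integral_of_tendsto_one_point
    (hcompat : ∀ (k n : ℕ) (ι : Fin k → Fin n), Function.Injective ι →
      ∀ (t : ℝ≥0) (x : Fin n → M),
        ((κ n t) x).map (fun y => y ∘ ι) = (κ k t) (x ∘ ι))
    (hF1 : ∀ (f : C(M, ℝ)) (x : M),
      Tendsto (fun t : ℝ≥0 => ∫ y, f (y 0) ∂ (κ 1 t) (fun _ => x)) (nhds 0) (nhds (f x)))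
    {n : ℕ} {h : (Fin n → M) → ℝ} (hh : Continuous h) (x : Fin n → M) :
    Tendsto (fun t : ℝ≥0 => ∫ y, h y ∂ (κ n t) x) (𝓝 0) (𝓝 (h x)) := by
  obtain ⟨C, hC⟩ := isCompact_univ.exists_bound_of_continuousOn hh.continuousOn
  replace hC (y) : |h y| ≤ C := hC y trivial
  rw [Metric.tendsto_nhds]
  intro ε hε
  obtain ⟨δ, hδ, hunif⟩ := Metric.uniformContinuous_iff.1
    (CompactSpace.uniformContinuous_of_continuous hh) (ε / 2) (half_pos hε)
  let E (i : Fin n) : Set (Fin n → M) := {p | δ / 2 < dist (p i) (x i)}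
  have hE (i : Fin n) : MeasurableSet (E i) :=
    (isOpen_lt continuous_const (by fun_prop)).measurableSet
  have hmarkov (t : ℝ≥0) (i : Fin n) : (κ n t x).real (E i) ≤
      (δ / 2)⁻¹ * ∫ y, dist (y 0) (x i) ∂κ 1 t fun _ => x i := by
    have hmap := hcompat 1 n (fun _ => i) (Function.injective_of_subsingleton _) t x
    have hmeas : Measurable fun y : Fin n → M => y ∘ fun _ : Fin 1 => i := by fun_prop
    have hdist : Continuous fun y : Fin 1 → M => dist (y 0) (x i) := by fun_prop
    rw [le_inv_mul_iff₀ (half_pos hδ)]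
    refine le_trans ?_ (mul_meas_ge_le_integral_of_nonneg (ae_of_all _ fun _ => dist_nonneg)
      hdist.integrable_of_compactSpace (δ / 2))
    gcongr
    change _ ≤ (κ 1 t (x ∘ fun _ => i)).real _
    rw [← hmap, map_measureReal_apply hmeas (measurableSet_le measurable_const hdist.measurable)]
    exact measureReal_mono fun p (hp : δ / 2 < _) => hp.le
  have hlim : Tendsto (fun t => ε / 2 + 2 * C * ∑ i,
      (δ / 2)⁻¹ * ∫ y, dist (y 0) (x i) ∂κ 1 t fun _ => x i) (𝓝 0) (𝓝 (ε / 2)) := by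
    have hi (i : Fin n) := hF1 ⟨fun z => dist z (x i), by fun_prop⟩ (x i)
    simp only [ContinuousMap.coe_mk, dist_self] at hi
    simpa using ((tendsto_finsetSum Finset.univ fun i _ =>
      (hi i).const_mul (δ / 2)⁻¹).const_mul (2 * C)).const_add (ε / 2)
  filter_upwards [hlim.eventually (gt_mem_nhds (half_lt_self hε))] with t ht
  refine lt_of_le_of_lt ?_ ht
  have hint : Integrable h (κ n t x) := hh.integrable_of_compactSpace
  have hsub : (∫ y, h y ∂κ n t x) - h x = ∫ y, (h y - h x) ∂κ n t x := by
    rw [integral_sub hint (integrable_const _)]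
    simp
  rw [Real.dist_eq, hsub]
  have hC₀ : 0 ≤ C := (abs_nonneg _).trans (hC x)
  refine (abs_integral_le_add_mul_sum_measureReal _ (hint.sub (integrable_const _))
    (half_pos hε).le (B := 2 * C)
    (fun y => (abs_sub _ _).trans (by linarith [hC x, hC y])) hE fun y hy => ?_).trans ?_
  · refine (hunif ((dist_pi_lt_iff hδ).2 fun i => ?_)).le
    exact (not_lt.1 (hy i)).trans_lt (half_lt_self hδ)
  · gcongr with i
    exact hmarkov t i

theorem continuous_integral_of_tendsto_two_point
    (hcompat : ∀ (k n : ℕ) (ι : Fin k → Fin n), Function.Injective ι →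
      ∀ (t : ℝ≥0) (x : Fin n → M),
        ((κ n t) x).map (fun y => y ∘ ι) = (κ k t) (x ∘ ι))
    {t : ℝ≥0} (hF2 : ∀ (x : M) (ε : ℝ), 0 < ε →
      Tendsto (fun y : M => ((κ 2 t) ![x, y]) {p | ε < dist (p 0) (p 1)}) (𝓝 x) (𝓝 0))
    {n : ℕ} {h : (Fin n → M) → ℝ} (hh : Continuous h) :
    Continuous fun x => ∫ y, h y ∂(κ n t) x := by
  obtain ⟨C, hC⟩ := isCompact_univ.exists_bound_of_continuousOn hh.continuousOn
  replace hC (y) : |h y| ≤ C := hC y trivial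
  rw [continuous_iff_continuousAt]
  intro x
  rw [ContinuousAt, Metric.tendsto_nhds]
  intro ε hε
  obtain ⟨δ, hδ, hunif⟩ := Metric.uniformContinuous_iff.1
    (CompactSpace.uniformContinuous_of_continuous hh) (ε / 2) (half_pos hε)
  let E (i : Fin n) : Set (Fin (n + n) → M) :=
    {p | δ / 2 < dist (p (Fin.castAdd n i)) (p (Fin.natAdd n i))}
  have hE (i : Fin n) : MeasurableSet (E i) :=
    (isOpen_lt continuous_const (by fun_prop)).measurableSet
  have hpair (y : Fin n → M) (i : Fin n) : (κ (n + n) t (Fin.append x y)).real (E i) =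
      (κ 2 t ![x i, y i]).real {p | δ / 2 < dist (p 0) (p 1)} := by
    let ι : Fin 2 → Fin (n + n) := ![Fin.castAdd n i, Fin.natAdd n i]
    have hne : Fin.castAdd n i ≠ Fin.natAdd n i :=
      Fin.ne_of_val_ne (i.2.trans_le (Nat.le_add_right n i)).ne
    have hι : Function.Injective ι := by
      intro a b hab
      fin_cases a <;> fin_cases b
      exacts [rfl, absurd hab hne, absurd hab.symm hne, rfl]
    have hxy : Fin.append x y ∘ ι = ![x i, y i] := by
      ext j
      fin_cases j
      exacts [Fin.append_left x y i, Fin.append_right x y i]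
    have hmeas : Measurable fun p : Fin (n + n) → M => p ∘ ι := by fun_prop
    rw [← hxy, ← hcompat 2 (n + n) ι hι, map_measureReal_apply hmeas
      (isOpen_lt continuous_const (by fun_prop)).measurableSet]
    rfl
  have hlim : Tendsto (fun y : Fin n → M => ε / 2 + 2 * C * ∑ i,
      (κ 2 t ![x i, y i]).real {p | δ / 2 < dist (p 0) (p 1)}) (𝓝 x) (𝓝 (ε / 2)) := by
    have hi (i : Fin n) : Tendsto (fun y : Fin n → M =>
        (κ 2 t ![x i, y i]).real {p | δ / 2 < dist (p 0) (p 1)}) (𝓝 x) (𝓝 0) :=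
      ((ENNReal.tendsto_toReal ENNReal.zero_ne_top).comp (hF2 (x i) _ (half_pos hδ))).comp
        ((continuous_apply i).tendsto x)
    simpa using ((tendsto_finsetSum Finset.univ fun i _ => hi i).const_mul (2 * C)).const_add
      (ε / 2)
  filter_upwards [hlim.eventually (gt_mem_nhds (half_lt_self hε))] with y hy
  refine lt_of_le_of_lt ?_ hy
  have hleft : Continuous fun p : Fin (n + n) → M => p ∘ Fin.castAdd n := by fun_prop
  have hright : Continuous fun p : Fin (n + n) → M => p ∘ Fin.natAdd n := by fun_prop
  have hx : ∫ z, h z ∂κ n t x =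
      ∫ p, h (p ∘ Fin.castAdd n) ∂κ (n + n) t (Fin.append x y) := by
    rw [← integral_map hleft.measurable.aemeasurable hh.aestronglyMeasurable,
      hcompat n (n + n) _ (Fin.castAdd_injective n n),
      show Fin.append x y ∘ Fin.castAdd n = x from funext (Fin.append_left x y)]
  have hy : ∫ z, h z ∂κ n t y =
      ∫ p, h (p ∘ Fin.natAdd n) ∂κ (n + n) t (Fin.append x y) := by
    rw [← integral_map hright.measurable.aemeasurable hh.aestronglyMeasurable,
      hcompat n (n + n) _ (Fin.natAdd_injective n n),
      show Fin.append x y ∘ Fin.natAdd n = y from funext (Fin.append_right x y)]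
  have hintl : Integrable (fun p => h (p ∘ Fin.castAdd n)) (κ (n + n) t (Fin.append x y)) :=
    (hh.comp hleft).integrable_of_compactSpace
  have hintr : Integrable (fun p => h (p ∘ Fin.natAdd n)) (κ (n + n) t (Fin.append x y)) :=
    (hh.comp hright).integrable_of_compactSpace
  rw [dist_comm, Real.dist_eq, hx, hy, ← integral_sub hintl hintr]
  simp only [← hpair]
  refine abs_integral_le_add_mul_sum_measureReal _ (hintl.sub hintr) (half_pos hε).le
    (fun p => (abs_sub _ _).trans
      (by linarith [hC (p ∘ Fin.castAdd n), hC (p ∘ Fin.natAdd n)])) hE fun p hp => ?_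
  refine (hunif ((dist_pi_lt_iff hδ).2 fun i => ?_)).le
  exact (not_lt.1 (hp i)).trans_lt (half_lt_self hδ)

end NPoint

/-- Lemma 1.11: a compatible family `(P_t^{(n)})` of semigroups of Markovian kernels on a
compact metric space `M` is constituted of Feller semigroups as soon as condition (F)
holds: the one-point semigroup is pointwise continuous at `t = 0`, and for all `x`,
`ε > 0`, `t > 0`, `P_t^{(2)} 1_{d > ε}(x, y) → 0` as `y → x`.  Then each `P_t^{(n)}` maps
`C(Mⁿ)` to `C(Mⁿ)` and `P_t^{(n)} h → h` pointwise, hence uniformly, as `t → 0`. -/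
theorem stmt5 {M : Type*} [MetricSpace M] [CompactSpace M]
    [MeasurableSpace M] [BorelSpace M]
    (κ : (n : ℕ) → ℝ≥0 → Kernel (Fin n → M) (Fin n → M))
    [hm : ∀ n t, IsMarkovKernel (κ n t)]
    (hsemi : ∀ (n : ℕ) (s t : ℝ≥0) (x : Fin n → M),
      ((κ n s) x).bind (κ n t) = (κ n (s + t)) x)
    (hcompat : ∀ (k n : ℕ) (ι : Fin k → Fin n), Function.Injective ι →
      ∀ (t : ℝ≥0) (x : Fin n → M),
        ((κ n t) x).map (fun y => y ∘ ι) = (κ k t) (x ∘ ι))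
    (hF1 : ∀ (f : C(M, ℝ)) (x : M),
      Tendsto (fun t : ℝ≥0 => ∫ y, f (y 0) ∂ (κ 1 t) (fun _ => x)) (nhds 0) (nhds (f x)))
    (hF2 : ∀ (x : M) (ε : ℝ), 0 < ε → ∀ t : ℝ≥0, 0 < t →
      Tendsto (fun y : M => ((κ 2 t) ![x, y]) {p | ε < dist (p 0) (p 1)})
        (nhds x) (nhds 0)) :
    ∀ (n : ℕ) (t : ℝ≥0) (h : (Fin n → M) → ℝ), Continuous h →
      (Continuous fun x => ∫ y, h y ∂ (κ n t) x) ∧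
      (∀ x, Tendsto (fun t : ℝ≥0 => ∫ y, h y ∂ (κ n t) x) (nhds 0) (nhds (h x))) ∧
      TendstoUniformly (fun (t : ℝ≥0) x => ∫ y, h y ∂ (κ n t) x) h (nhds 0) := by
  have hpt (n : ℕ) (h : (Fin n → M) → ℝ) (hh : Continuous h) (x : Fin n → M) :
      Tendsto (fun t : ℝ≥0 => ∫ y, h y ∂κ n t x) (𝓝 0) (𝓝 (h x)) :=
    tendsto_integral_of_tendsto_one_point hcompat hF1 hh x
  have hcont (n : ℕ) (t : ℝ≥0) (h : (Fin n → M) → ℝ) (hh : Continuous h) :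
      Continuous fun x => ∫ y, h y ∂κ n t x := by
    rcases eq_or_ne t 0 with rfl | ht
    · have : (fun x => ∫ y, h y ∂κ n 0 x) = h :=
        funext fun x => tendsto_nhds_unique (tendsto_pure_nhds _ _)
          ((hpt n h hh x).mono_left (pure_le_nhds 0))
      rwa [this]
    · exact continuous_integral_of_tendsto_two_point hcompat
        (fun x ε hε => hF2 x ε hε t (pos_iff_ne_zero.2 ht)) hh
  intro n t h hh
  have hκ : IsPointwiseFeller (κ n) := ⟨hsemi n, hcont n, hpt n⟩
  exact ⟨hcont n t h hh, hpt n h hh, hκ.tendstoUniformly_integral hh⟩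
end

section
/- Let (P_t^{(n)})_{n≥1} be a compatible family of Feller semigroups on a compact metric space M. For each k ≥ 1, define on the algebra 𝒜_k of functions g(μ₁,…,μ_k) = ⟨f, μ₁^{⊗n₁} ⊗ … ⊗ μ_k^{⊗n_k}⟩ (f ∈ C(Mⁿ), n = n₁+…+n_k) the operator Π_t^{(k)} g(μ) = ⟨P_t^{(n)} f, μ₁^{⊗n₁} ⊗ … ⊗ μ_k^{⊗n_k}⟩. Then Π_t^{(k)} is well defined, positive (g ≥ 0 implies Π_t^{(k)} g ≥ 0), and Π_t^{(k)} 1 = 1; hence it extends to a Markovian semigroup on C(𝒫(M)^k). Positivity is proved via the empirical-measure approximation: if μ_t^{N,i} = N^{-1} Σ_{j=1}^N δ_{X_t^{j,i}} where (X^{j,i}) is the Nk-point motion started from i.i.d. points of law μ_i, then E[g(μ_t^N)] → Π_t^{(k)} g(μ₁,…,μ_k) as N → ∞. -/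
open MeasureTheory ProbabilityTheory Filter Topology
open scoped NNReal

/-- Transport of an `ℕ`-indexed compatible family of kernels to an arbitrary finite index
type, via a bijection with `Fin (card ι)`. -/
noncomputable def kappaOn {M : Type*} [MeasurableSpace M]
    (κ : (n : ℕ) → ℝ≥0 → Kernel (Fin n → M) (Fin n → M))
    (ι : Type*) [Fintype ι] (t : ℝ≥0) : Kernel (ι → M) (ι → M) :=
  (((κ (Fintype.card ι) t).comap (fun x : ι → M => x ∘ (Fintype.equivFin ι).symm)
      (measurable_pi_lambda _ fun _ => measurable_pi_apply _)).map
    (fun y => y ∘ (Fintype.equivFin ι)))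


section Auxiliary

variable {M : Type*} [MeasurableSpace M]

lemma measurable_comp_left {ι J : Type*} (e : ι → J) :
    Measurable fun y : J → M => y ∘ e :=
  measurable_pi_lambda _ fun _ => measurable_pi_apply _

instance isMarkovKernel_kappaOn (κ : (n : ℕ) → ℝ≥0 → Kernel (Fin n → M) (Fin n → M))
    [∀ n t, IsMarkovKernel (κ n t)] (ι : Type*) [Fintype ι] (t : ℝ≥0) :
    IsMarkovKernel (kappaOn κ ι t) :=
  Kernel.IsMarkovKernel.map _ (measurable_comp_left _)

lemma kappaOn_apply (κ : (n : ℕ) → ℝ≥0 → Kernel (Fin n → M) (Fin n → M))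
    (ι : Type*) [Fintype ι] (t : ℝ≥0) (x : ι → M) :
    kappaOn κ ι t x =
      (κ (Fintype.card ι) t (x ∘ (Fintype.equivFin ι).symm)).map
        (fun y => y ∘ Fintype.equivFin ι) := by
  rw [kappaOn, Kernel.map_apply _ (measurable_comp_left _), Kernel.comap_apply]

/-- Compatibility extends from `Fin n` to arbitrary finite index types. -/
lemma kappaOn_map_comp {κ : (n : ℕ) → ℝ≥0 → Kernel (Fin n → M) (Fin n → M)}
    (hcompat : ∀ (k n : ℕ) (ι : Fin k → Fin n), Function.Injective ι →
      ∀ (t : ℝ≥0) (x : Fin n → M),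
        ((κ n t) x).map (fun y => y ∘ ι) = (κ k t) (x ∘ ι))
    {ι J : Type*} [Fintype ι] [Fintype J] (t : ℝ≥0) {e : ι → J}
    (he : Function.Injective e) (x : J → M) :
    (kappaOn κ J t x).map (fun y => y ∘ e) = kappaOn κ ι t (x ∘ e) := by
  rw [kappaOn_apply, kappaOn_apply,
    Measure.map_map (measurable_comp_left _) (measurable_comp_left _)]
  have h := hcompat _ _ (Fintype.equivFin J ∘ e ∘ (Fintype.equivFin ι).symm)
    ((Fintype.equivFin J).injective.comp (he.comp (Fintype.equivFin ι).symm.injective)) t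
    (x ∘ (Fintype.equivFin J).symm)
  have hx : (x ∘ (Fintype.equivFin J).symm) ∘ Fintype.equivFin J ∘ e ∘ (Fintype.equivFin ι).symm
      = (x ∘ e) ∘ (Fintype.equivFin ι).symm := by
    ext i; simp
  rw [hx] at h
  rw [← h, Measure.map_map (measurable_comp_left _) (measurable_comp_left _)]
  congr 1
  ext y i
  simp

/-- The marginal of a product of probability measures along an injection. -/
lemma pi_map_comp_injective {ι J : Type*} [Fintype ι] [Fintype J] (ν : J → Measure M)
    [∀ j, IsProbabilityMeasure (ν j)] {e : ι → J} (he : Function.Injective e) :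
    (Measure.pi ν).map (fun y => y ∘ e) = Measure.pi fun i => ν (e i) := by
  have h : iIndepFun (fun j (y : J → M) => y j) (Measure.pi ν) :=
    iIndepFun_pi (X := fun _ => id) fun _ => aemeasurable_id
  have h' := (iIndepFun_iff_map_fun_eq_pi_map
    fun i => (measurable_pi_apply (e i)).aemeasurable).1 (h.precomp he)
  refine h'.trans (congrArg _ (funext fun i => ?_))
  exact (measurePreserving_eval ν (e i)).map_eq

/-- Integrating against products of empirical measures is averaging over all samples. -/
lemma integral_pi_empirical {S : Type*} [Fintype S] [DecidableEq S] {N : ℕ} [NeZero N]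
    (y : S → Fin N → M) {f : (S → M) → ℝ} (hf : Measurable f) :
    ∫ z, f z ∂(Measure.pi fun s =>
        ((PMF.uniformOfFintype (Fin N)).toMeasure.map (y s)))
      = (∑ j : S → Fin N, f fun s => y s (j s)) / (N : ℝ) ^ Fintype.card S := by
  have hy (s : S) : Measurable (y s) := measurable_of_countable _
  rw [← Measure.pi_map_pi fun s => (hy s).aemeasurable,
    integral_map (measurable_of_countable _).aemeasurable hf.aestronglyMeasurable,
    integral_fintype .of_finite]
  simp [measureReal_def, Finset.mul_sum, div_eq_inv_mul]

lemma integral_bind_kernel {X Y : Type*} [MeasurableSpace X] [MeasurableSpace Y]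
    (ν : Measure X) (K : Kernel X Y) [SFinite ν] [IsSFiniteKernel K]
    {f : Y → ℝ} (hf : Integrable f (ν.bind K)) :
    ∫ y, f y ∂ν.bind K = ∫ x, ∫ y, f y ∂K x ∂ν := by
  rw [Measure.comp_eq_comp_const_apply] at hf ⊢
  rw [Kernel.integral_comp hf, Kernel.const_apply]

/-- Marginals of the motion on `J → M` started from a product law. -/
lemma integral_comp_bind_kappaOn {κ : (n : ℕ) → ℝ≥0 → Kernel (Fin n → M) (Fin n → M)}
    [∀ n t, IsMarkovKernel (κ n t)]
    (hcompat : ∀ (k n : ℕ) (ι : Fin k → Fin n), Function.Injective ι →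
      ∀ (t : ℝ≥0) (x : Fin n → M),
        ((κ n t) x).map (fun y => y ∘ ι) = (κ k t) (x ∘ ι))
    {ι J : Type*} [Fintype ι] [Fintype J] (t : ℝ≥0) (ν : J → Measure M)
    [∀ j, IsProbabilityMeasure (ν j)] {e : ι → J} (he : Function.Injective e)
    {f : (ι → M) → ℝ} (hf : Measurable f)
    (hfi : Integrable (fun y : J → M => f (y ∘ e))
      ((Measure.pi ν).bind (kappaOn κ J t))) :
    ∫ y, f (y ∘ e) ∂(Measure.pi ν).bind (kappaOn κ J t)
      = ∫ x, (∫ y, f y ∂kappaOn κ ι t x) ∂Measure.pi fun i => ν (e i) := by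
  have hm := hf.stronglyMeasurable.integral_kernel (κ := kappaOn κ ι t)
  rw [integral_bind_kernel _ _ hfi, ← pi_map_comp_injective ν he,
    integral_map (measurable_comp_left e).aemeasurable hm.aestronglyMeasurable]
  refine integral_congr_ae (.of_forall fun x => ?_)
  simp only
  rw [← kappaOn_map_comp hcompat t he x,
    integral_map (measurable_comp_left e).aemeasurable hf.aestronglyMeasurable]

/-- An average over all maps `S → Fin N` is asymptotically an average over injections. -/
lemma tendsto_average_of_injective {S : Type*} [Fintype S] [DecidableEq S]
    {a : (N : ℕ) → (S → Fin N) → ℝ} {C L : ℝ} (hC : ∀ N j, |a N j| ≤ C)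
    (hL : ∀ N j, Function.Injective j → a N j = L) :
    Tendsto (fun N : ℕ => (∑ j, a N j) / (N : ℝ) ^ Fintype.card S) atTop (𝓝 L) := by
  classical
  set d := Fintype.card S
  have hlim : Tendsto (fun N : ℕ => (N.descFactorial d : ℝ) / (N : ℝ) ^ d) atTop (𝓝 1) := by
    refine (Asymptotics.isEquivalent_iff_tendsto_one ?_).1 (isEquivalent_descFactorial d)
    filter_upwards [eventually_gt_atTop 0] with N hN
    positivity
  have hcard (N : ℕ) :
      ((Finset.univ.filter fun j : S → Fin N => Function.Injective j).card : ℝ)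
        = N.descFactorial d := by
    rw [← Fintype.card_subtype,
      Fintype.card_congr (Equiv.subtypeInjectiveEquivEmbedding S (Fin N)),
      Fintype.card_embedding_eq, Fintype.card_fin]
  refine tendsto_iff_norm_sub_tendsto_zero.2 (squeeze_zero' (.of_forall fun _ => norm_nonneg _)
    (g := fun N : ℕ => (C + |L|) * (1 - (N.descFactorial d : ℝ) / (N : ℝ) ^ d)) ?_ ?_)
  · filter_upwards [eventually_gt_atTop 0] with N hN
    have hpos : (0 : ℝ) < (N : ℝ) ^ d := by positivity
    have hsum : |(∑ j, a N j) - (N : ℝ) ^ d * L|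
        ≤ (C + |L|) * ((N : ℝ) ^ d - N.descFactorial d) := calc
      _ = |∑ j : S → Fin N, (a N j - L)| := by
        rw [Finset.sum_sub_distrib]; simp [d]
      _ ≤ ∑ j : S → Fin N, |a N j - L| := Finset.abs_sum_le_sum_abs _ _
      _ ≤ ∑ j : S → Fin N, (C + |L|) * (1 - if Function.Injective j then 1 else 0) := by
        refine Finset.sum_le_sum fun j _ => ?_
        split_ifs with h
        · simp [hL N j h]
        · simpa using (abs_sub (a N j) L).trans (add_le_add_left (hC N j) _)
      _ = _ := by
        rw [← Finset.mul_sum, Finset.sum_sub_distrib, Finset.sum_boole, hcard]; simp [d]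
    have hrw : (∑ j, a N j) / (N : ℝ) ^ d - L
        = ((∑ j, a N j) - (N : ℝ) ^ d * L) / (N : ℝ) ^ d := by field_simp
    rw [hrw, Real.norm_eq_abs, abs_div, abs_of_pos hpos, div_le_iff₀ hpos]
    refine hsum.trans_eq ?_
    field_simp
  · simpa using (hlim.const_sub 1).const_mul (C + |L|)

variable [MetricSpace M] [CompactSpace M] [BorelSpace M]

lemma integrable_of_continuous_pi {S : Type*} [Fintype S] (ν : Measure (S → M))
    [IsFiniteMeasure ν] {f : (S → M) → ℝ} (hf : Continuous f) : Integrable f ν :=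
  hf.integrable_of_hasCompactSupport (.of_compactSpace f)

/-- The sample average over `y : Fin N × Fin k → M` is the value at the empirical measures. -/
lemma average_eq_integral_pi_empirical {k N : ℕ} [NeZero N] (n : Fin k → ℕ)
    {f : ((Σ i : Fin k, Fin (n i)) → M) → ℝ} (hf : Continuous f) (y : Fin N × Fin k → M) :
    (∑ j : (Σ i : Fin k, Fin (n i)) → Fin N, f (fun s => y (j s, s.1))) / (N : ℝ) ^ (∑ i, n i)
      = ∫ z, f z ∂(Measure.pi fun s : Σ i : Fin k, Fin (n i) =>
        (PMF.uniformOfFintype (Fin N)).toMeasure.map fun l => y (l, s.1)) := by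
  rw [integral_pi_empirical (fun s l => y (l, s.1)) hf.measurable]
  simp

/-- Expectations of polynomial functionals at the empirical measures of the `Nk`-point motion
converge. -/
lemma tendsto_integral_empirical {κ : (n : ℕ) → ℝ≥0 → Kernel (Fin n → M) (Fin n → M)}
    [∀ n t, IsMarkovKernel (κ n t)]
    (hcompat : ∀ (k n : ℕ) (ι : Fin k → Fin n), Function.Injective ι →
      ∀ (t : ℝ≥0) (x : Fin n → M),
        ((κ n t) x).map (fun y => y ∘ ι) = (κ k t) (x ∘ ι))
    {k : ℕ} (t : ℝ≥0) (n : Fin k → ℕ) {f : ((Σ i : Fin k, Fin (n i)) → M) → ℝ}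
    (hf : Continuous f) (μ : Fin k → Measure M) [∀ i, IsProbabilityMeasure (μ i)] :
    Tendsto (fun N : ℕ =>
        ∫ y : Fin N × Fin k → M,
          (∑ j : (Σ i : Fin k, Fin (n i)) → Fin N,
              f (fun s => y (j s, s.1))) / (N : ℝ) ^ (∑ i, n i)
          ∂((Measure.pi fun p : Fin N × Fin k => μ p.2).bind (kappaOn κ (Fin N × Fin k) t)))
      atTop
      (𝓝 (∫ x, (∫ y, f y ∂(kappaOn κ (Σ i : Fin k, Fin (n i)) t) x)
          ∂Measure.pi fun s : Σ i : Fin k, Fin (n i) => μ s.1)) := by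
  obtain ⟨C, hC⟩ := isCompact_univ.exists_bound_of_continuousOn hf.continuousOn
  have hint (N : ℕ) (j : (Σ i : Fin k, Fin (n i)) → Fin N) :
      Integrable (fun y : Fin N × Fin k → M => f (fun s => y (j s, s.1)))
        ((Measure.pi fun p : Fin N × Fin k => μ p.2).bind (kappaOn κ (Fin N × Fin k) t)) :=
    integrable_of_continuous_pi _ (by fun_prop)
  have h := tendsto_average_of_injective
    (a := fun N (j : (Σ i : Fin k, Fin (n i)) → Fin N) => ∫ y, f (fun s => y (j s, s.1))
      ∂((Measure.pi fun p : Fin N × Fin k => μ p.2).bind (kappaOn κ (Fin N × Fin k) t)))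
    (C := C) (L := ∫ x, (∫ y, f y ∂(kappaOn κ (Σ i : Fin k, Fin (n i)) t) x)
          ∂Measure.pi fun s : Σ i : Fin k, Fin (n i) => μ s.1)
    (fun N j => by
      refine (norm_integral_le_of_norm_le_const (C := C)
        (.of_forall fun y => hC _ (Set.mem_univ _))).trans_eq ?_
      simp)
    (fun N j hj => integral_comp_bind_kappaOn hcompat t (fun p : Fin N × Fin k => μ p.2)
      (e := fun s => (j s, s.1)) (fun s s' hs => hj (congrArg Prod.fst hs)) hf.measurable
      (hint N j))
  refine h.congr fun N => ?_
  rw [integral_div, integral_finsetSum _ fun j _ => hint N j]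
  simp

end Auxiliary

/-- The Markovian operators `Π_t^{(k)}` on functions of `k` probability measures, defined
on the algebra `𝒜_k` by `Π_t^{(k)} g(μ) = ⟨P_t^{(n)} f, μ₁^{⊗n₁} ⊗ … ⊗ μ_k^{⊗n_k}⟩` for
`g(μ) = ⟨f, μ₁^{⊗n₁} ⊗ … ⊗ μ_k^{⊗n_k}⟩`, are well defined (independent of the
representation), positive, unital, and satisfy the empirical-measure approximation:
`E[g(μ_t^N)] → Π_t^{(k)} g(μ)` as `N → ∞`, where `μ_t^{N,i}` are the empirical measures
of the `Nk`-point motion started from i.i.d. points of laws `μ_i`. -/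
theorem stmt7 {M : Type*} [MetricSpace M] [CompactSpace M]
    [MeasurableSpace M] [BorelSpace M]
    (κ : (n : ℕ) → ℝ≥0 → Kernel (Fin n → M) (Fin n → M))
    [hm : ∀ n t, IsMarkovKernel (κ n t)]
    (hsemi : ∀ (n : ℕ) (s t : ℝ≥0) (x : Fin n → M),
      ((κ n s) x).bind (κ n t) = (κ n (s + t)) x)
    (hFeller : ∀ (n : ℕ) (t : ℝ≥0) (h : (Fin n → M) → ℝ), Continuous h →
      (Continuous fun x => ∫ y, h y ∂ (κ n t) x) ∧
      ∀ x, Tendsto (fun s : ℝ≥0 => ∫ y, h y ∂ (κ n s) x) (nhds 0) (nhds (h x)))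
    (hcompat : ∀ (k n : ℕ) (ι : Fin k → Fin n), Function.Injective ι →
      ∀ (t : ℝ≥0) (x : Fin n → M),
        ((κ n t) x).map (fun y => y ∘ ι) = (κ k t) (x ∘ ι))
    (k : ℕ) (t : ℝ≥0) :
    -- well-definedness on 𝒜_k: two representations of the same function give the same Π
    (∀ (n n' : Fin k → ℕ)
        (f : ((Σ i : Fin k, Fin (n i)) → M) → ℝ)
        (f' : ((Σ i : Fin k, Fin (n' i)) → M) → ℝ),
        Continuous f → Continuous f' →
        (∀ μ : Fin k → Measure M, ∀ hμ : (∀ i, IsProbabilityMeasure (μ i)),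
          haveI := hμ
          (∫ y, f y ∂ Measure.pi fun s : Σ i : Fin k, Fin (n i) => μ s.1)
            = ∫ y, f' y ∂ Measure.pi fun s : Σ i : Fin k, Fin (n' i) => μ s.1) →
        ∀ μ : Fin k → Measure M, ∀ hμ : (∀ i, IsProbabilityMeasure (μ i)),
          haveI := hμ
          (∫ x, (∫ y, f y ∂ (kappaOn κ (Σ i : Fin k, Fin (n i)) t) x)
              ∂ Measure.pi fun s : Σ i : Fin k, Fin (n i) => μ s.1)
            = ∫ x, (∫ y, f' y ∂ (kappaOn κ (Σ i : Fin k, Fin (n' i)) t) x)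
              ∂ Measure.pi fun s : Σ i : Fin k, Fin (n' i) => μ s.1) ∧
    -- positivity: if g ≥ 0 as a function of the measures, then Π g ≥ 0
    (∀ (n : Fin k → ℕ) (f : ((Σ i : Fin k, Fin (n i)) → M) → ℝ), Continuous f →
      (∀ μ : Fin k → Measure M, ∀ hμ : (∀ i, IsProbabilityMeasure (μ i)),
        haveI := hμ
        0 ≤ ∫ y, f y ∂ Measure.pi fun s : Σ i : Fin k, Fin (n i) => μ s.1) →
      ∀ μ : Fin k → Measure M, ∀ hμ : (∀ i, IsProbabilityMeasure (μ i)),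
        haveI := hμ
        0 ≤ ∫ x, (∫ y, f y ∂ (kappaOn κ (Σ i : Fin k, Fin (n i)) t) x)
              ∂ Measure.pi fun s : Σ i : Fin k, Fin (n i) => μ s.1) ∧
    -- Π 1 = 1
    (∀ (n : Fin k → ℕ) (μ : Fin k → Measure M), ∀ hμ : (∀ i, IsProbabilityMeasure (μ i)),
      haveI := hμ
      (∫ x, (∫ y, (1 : ℝ) ∂ (kappaOn κ (Σ i : Fin k, Fin (n i)) t) x)
          ∂ Measure.pi fun s : Σ i : Fin k, Fin (n i) => μ s.1) = 1) ∧
    -- empirical-measure approximation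
    (∀ (n : Fin k → ℕ) (f : ((Σ i : Fin k, Fin (n i)) → M) → ℝ), Continuous f →
      ∀ μ : Fin k → Measure M, ∀ hμ : (∀ i, IsProbabilityMeasure (μ i)),
        haveI := hμ
        Tendsto (fun N : ℕ =>
            ∫ y : Fin N × Fin k → M,
              (∑ j : (Σ i : Fin k, Fin (n i)) → Fin N,
                  f (fun s => y (j s, s.1))) / (N : ℝ) ^ (∑ i, n i)
              ∂ ((Measure.pi fun p : Fin N × Fin k => μ p.2).bind
                  fun x => (kappaOn κ (Fin N × Fin k) t) x))
          atTop
          (nhds (∫ x, (∫ y, f y ∂ (kappaOn κ (Σ i : Fin k, Fin (n i)) t) x)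
              ∂ Measure.pi fun s : Σ i : Fin k, Fin (n i) => μ s.1))) := by
  refine ⟨fun n n' f f' hf hf' h μ hμ => ?_, fun n f hf h μ hμ => ?_, fun n μ hμ => ?_,
    fun n f hf μ hμ => tendsto_integral_empirical hcompat t n hf μ⟩
  · refine tendsto_nhds_unique (tendsto_integral_empirical hcompat t n hf μ)
      ((tendsto_integral_empirical hcompat t n' hf' μ).congr' ?_)
    filter_upwards [eventually_ne_atTop 0] with N hN
    have : NeZero N := ⟨hN⟩
    refine integral_congr_ae (.of_forall fun y => ?_)
    simp only
    rw [average_eq_integral_pi_empirical n hf, average_eq_integral_pi_empirical n' hf']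
    exact (h (fun i => (PMF.uniformOfFintype (Fin N)).toMeasure.map fun l => y (l, i)) fun i =>
      Measure.isProbabilityMeasure_map (measurable_of_countable _).aemeasurable).symm
  · refine ge_of_tendsto (tendsto_integral_empirical hcompat t n hf μ) ?_
    filter_upwards [eventually_ne_atTop 0] with N hN
    have : NeZero N := ⟨hN⟩
    refine integral_nonneg fun y => ?_
    simp only [Pi.zero_apply]
    rw [average_eq_integral_pi_empirical n hf]
    exact h (fun i => (PMF.uniformOfFintype (Fin N)).toMeasure.map fun l => y (l, i)) fun i =>
      Measure.isProbabilityMeasure_map (measurable_of_countable _).aemeasurable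
  · simp
end
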